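/- Let Q = x^{2m+1} + ∑_{j=0}^{2m} α_j x^j ∈ 𝔽_2[x] be a monic irreducible polynomial of odd degree ℓ = 2m+1. Then the composed polynomial Q(α_{2m} + x + x^2) ∈ 𝔽_2[x] decomposes as a product F·G of two monic irreducible polynomials F, G ∈ 𝔽_2[x], each of degree ℓ = 2m+1, having different traces (i.e., the coefficients of x^{ℓ−1} in F and in G are distinct elements of 𝔽_2). -/

import Mathlib

open Polynomial

open IntermediateField in
theorem trace_eq_neg_nextCoeff_minpoly_of_adjoin_eq_top {K L : Type*} [Field K] [Field L]
    [Algebra K L] [FiniteDimensional K L] {x : L} (hx : K⟮x⟯ = ⊤) :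
    Algebra.trace K L x = -(minpoly K x).nextCoeff := by
  rw [trace_eq_finrank_mul_minpoly_nextCoeff, hx, IntermediateField.finrank_top, Nat.cast_one,
    one_mul]

theorem halfTrace_add_sq {R : Type*} [CommRing R] [CharP R 2] (c : R) (m : ℕ) :
    (∑ i ∈ Finset.range m, c ^ 2 ^ (2 * i)) + (∑ i ∈ Finset.range m, c ^ 2 ^ (2 * i)) ^ 2 =
      ∑ j ∈ Finset.range (2 * m), c ^ 2 ^ j := by
  induction m with
  | zero => simp
  | succ m ih =>
    rw [show 2 * (m + 1) = 2 * m + 1 + 1 by ring, Finset.sum_range_succ,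
      Finset.sum_range_succ _ (_ + 1), Finset.sum_range_succ _ (2 * m), ← ih, CharTwo.add_sq, ← pow_mul, ← pow_succ]
    ring

/-- In an odd degree extension of `𝔽₂`, the half-trace solves `y + y² = c` whenever `c` has
trace zero. -/
theorem exists_add_sq_eq_of_trace_eq_zero {L : Type*} [Field L] [Algebra (ZMod 2) L] [Finite L]
    {m : ℕ} (hL : Module.finrank (ZMod 2) L = 2 * m + 1) {c : L}
    (hc : Algebra.trace (ZMod 2) L c = 0) : ∃ y : L, y + y ^ 2 = c := by
  have : CharP L 2 := charP_of_injective_algebraMap (algebraMap (ZMod 2) L).injective 2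
  refine ⟨∑ i ∈ Finset.range (m + 1), c ^ 2 ^ (2 * i), ?_⟩
  have htr := FiniteField.algebraMap_trace_eq_sum_pow (ZMod 2) L c
  rw [hc, map_zero, hL, Nat.card_zmod] at htr
  have hcard : Nat.card L = 2 ^ (2 * m + 1) := by
    rw [Module.natCard_eq_pow_finrank (K := ZMod 2), hL, Nat.card_zmod]
  rw [halfTrace_add_sq, show 2 * (m + 1) = 2 * m + 1 + 1 by ring, Finset.sum_range_succ, ← htr,
    zero_add, ← hcard]
  have := Fintype.ofFinite L
  rw [Nat.card_eq_fintype_card, FiniteField.pow_card]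

theorem odd_degree_comp_factors (m : ℕ)
    (Q : Polynomial (ZMod 2)) (hmonic : Q.Monic) (hirr : Irreducible Q)
    (hdeg : Q.natDegree = 2 * m + 1) :
    ∃ F G : Polynomial (ZMod 2), F.Monic ∧ G.Monic ∧ Irreducible F ∧ Irreducible G ∧
      F.natDegree = 2 * m + 1 ∧ G.natDegree = 2 * m + 1 ∧
      F.coeff (2 * m) ≠ G.coeff (2 * m) ∧
      Q.comp (C (Q.coeff (2 * m)) + X + X ^ 2) = F * G := by
  have : Fact (Irreducible Q) := ⟨hirr⟩
  let L := AdjoinRoot Q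
  let pb := AdjoinRoot.powerBasis hirr.ne_zero
  have : FiniteDimensional (ZMod 2) L := pb.finite
  have : Finite L := Module.finite_of_finite (ZMod 2)
  have : CharP L 2 := charP_of_injective_algebraMap (algebraMap (ZMod 2) L).injective 2
  have hL : Module.finrank (ZMod 2) L = 2 * m + 1 := by rw [pb.finrank, ← hdeg]; rfl
  have hodd : ((2 * m + 1 : ℕ) : ZMod 2) = 1 := by
    rw [Nat.cast_add, Nat.cast_mul, ZMod.natCast_self]; simp
  have htrace (x : L) (hx : IntermediateField.adjoin (ZMod 2) {x} = ⊤) :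
      Algebra.trace (ZMod 2) L x = (minpoly (ZMod 2) x).coeff (2 * m) := by
    have hd := (Field.primitive_element_iff_minpoly_natDegree_eq (ZMod 2) x).1 hx
    rw [trace_eq_neg_nextCoeff_minpoly_of_adjoin_eq_top hx, CharTwo.neg_eq,
      nextCoeff_of_natDegree_pos (by omega), hd, hL, Nat.add_sub_cancel]
  have htrace_add (x : L) (a : ZMod 2) : Algebra.trace (ZMod 2) L (x + algebraMap _ L a) =
      Algebra.trace (ZMod 2) L x + a := by
    rw [map_add, Algebra.trace_algebraMap, hL, nsmul_eq_mul, hodd, one_mul]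
  set a := Q.coeff (2 * m) with ha
  let β : L := AdjoinRoot.root Q
  have hβtop : IntermediateField.adjoin (ZMod 2) {β} = ⊤ :=
    IntermediateField.adjoin_root_eq_top Q
  have hβmin : minpoly (ZMod 2) β = Q := by
    rw [AdjoinRoot.minpoly_root hirr.ne_zero, hmonic.leadingCoeff, inv_one, C_1, mul_one]
  obtain ⟨γ, hγ⟩ := exists_add_sq_eq_of_trace_eq_zero hL (c := β + algebraMap _ L a)
    (by rw [htrace_add, htrace β hβtop, hβmin, ← ha, CharTwo.add_self_eq_zero])
  have hγ' : (γ + 1) + (γ + 1) ^ 2 = β + algebraMap _ L a := by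
    rw [← hγ, CharTwo.add_sq]
    linear_combination CharTwo.add_self_eq_zero (1 : L)
  have hβ_eq (y : L) (hy : y + y ^ 2 = β + algebraMap _ L a) :
      algebraMap _ L a + y + y ^ 2 = β := by
    linear_combination hy + CharTwo.add_self_eq_zero (algebraMap _ L a)
  have htop (y : L) (hy : y + y ^ 2 = β + algebraMap _ L a) :
      IntermediateField.adjoin (ZMod 2) {y} = ⊤ := by
    rw [eq_top_iff, ← hβtop, IntermediateField.adjoin_simple_le_iff, ← hβ_eq y hy]
    have := IntermediateField.mem_adjoin_simple_self (ZMod 2) y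
    exact add_mem (add_mem (algebraMap_mem _ a) this) (pow_mem this 2)
  have hdeg_min (y : L) (hy : y + y ^ 2 = β + algebraMap _ L a) :
      (minpoly (ZMod 2) y).natDegree = 2 * m + 1 := by
    rw [(Field.primitive_element_iff_minpoly_natDegree_eq (ZMod 2) y).1 (htop y hy), hL]
  have hdvd (y : L) (hy : y + y ^ 2 = β + algebraMap _ L a) :
      minpoly (ZMod 2) y ∣ Q.comp (C a + X + X ^ 2) := by
    apply minpoly.dvd
    rw [aeval_comp]
    simp only [map_add, aeval_C, aeval_X, map_pow]
    rw [hβ_eq y hy]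
    exact (AdjoinRoot.aeval_eq Q).trans AdjoinRoot.mk_self
  have hmon (y : L) : (minpoly (ZMod 2) y).Monic := minpoly.monic (.of_finite _ _)
  have hirred (y : L) : Irreducible (minpoly (ZMod 2) y) := minpoly.irreducible (.of_finite _ _)
  have hne : (minpoly (ZMod 2) γ).coeff (2 * m) ≠ (minpoly (ZMod 2) (γ + 1)).coeff (2 * m) := by
    have h1 := htrace_add γ 1
    rw [map_one] at h1
    rw [← htrace _ (htop _ hγ), ← htrace _ (htop _ hγ'), h1]
    simp
  have hcop : IsCoprime (minpoly (ZMod 2) γ) (minpoly (ZMod 2) (γ + 1)) := by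
    refine (hirred γ).coprime_iff_not_dvd.2 fun h => hne ?_
    rw [eq_of_monic_of_dvd_of_natDegree_le (hmon γ) (hmon _) h
      (by rw [hdeg_min _ hγ, hdeg_min _ hγ'])]
  have hpdeg : (C a + X + X ^ 2 : (ZMod 2)[X]).natDegree = 2 := by compute_degree!
  have hpmonic : (C a + X + X ^ 2 : (ZMod 2)[X]).Monic := by monicity!
  refine ⟨minpoly (ZMod 2) γ, minpoly (ZMod 2) (γ + 1), hmon _, hmon _, hirred _, hirred _,
    hdeg_min _ hγ, hdeg_min _ hγ', hne, ?_⟩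
  refine eq_of_monic_of_dvd_of_natDegree_le ((hmon _).mul (hmon _))
    (hmonic.comp hpmonic (by omega)) (hcop.mul_dvd (hdvd _ hγ) (hdvd _ hγ')) ?_
  rw [natDegree_comp, (hmon _).natDegree_mul (hmon _), hpdeg, hdeg, hdeg_min _ hγ,
    hdeg_min _ hγ']
  omega
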